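/- Let k be a field of characteristic not 2, and A = k[h^{±1}](σ_inv, 1) with σ_inv(h) = h^{-1}. For central elements z_1, z_2 ∈ Z(A), there is a (unique) k-linear derivation D_{z_1,z_2} of A with D_{z_1,z_2}(h) = (h^2 − 1)z_1, D_{z_1,z_2}(x) = z_2 x, D_{z_1,z_2}(y) = −z_2 y. Moreover, if (z_1, z_2) ≠ (0, 0) then D_{z_1,z_2} is an outer derivation, i.e. it is not equal to ad_t for any t ∈ A. -/

import Mathlib

open LaurentPolynomial

/-- The defining relations of the degree-one generalized Weyl algebra `k[h^{±1}](σ, a)`: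
the generators `Sum.inl p` (for `p` a Laurent polynomial) give a copy of `k[h^{±1}]`,
and the generators `x = Sum.inr 0` and `y = Sum.inr 1` satisfy
`y x = a`, `x y = σ a`, `x r = σ(r) x` and `y r = σ⁻¹(r) y` for all `r ∈ k[h^{±1}]`. -/
inductive GWARel (k : Type*) [CommRing k] (σ : LaurentPolynomial k ≃ₐ[k] LaurentPolynomial k)
    (a : LaurentPolynomial k) :
    FreeAlgebra k (LaurentPolynomial k ⊕ Fin 2) →
      FreeAlgebra k (LaurentPolynomial k ⊕ Fin 2) → Prop
  | add (r s : LaurentPolynomial k) :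
      GWARel k σ a (FreeAlgebra.ι k (Sum.inl (r + s)))
        (FreeAlgebra.ι k (Sum.inl r) + FreeAlgebra.ι k (Sum.inl s))
  | mul (r s : LaurentPolynomial k) :
      GWARel k σ a (FreeAlgebra.ι k (Sum.inl (r * s)))
        (FreeAlgebra.ι k (Sum.inl r) * FreeAlgebra.ι k (Sum.inl s))
  | smul (c : k) (r : LaurentPolynomial k) :
      GWARel k σ a (FreeAlgebra.ι k (Sum.inl (c • r))) (c • FreeAlgebra.ι k (Sum.inl r))
  | one : GWARel k σ a (FreeAlgebra.ι k (Sum.inl 1)) 1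
  | xr (r : LaurentPolynomial k) :
      GWARel k σ a (FreeAlgebra.ι k (Sum.inr 0) * FreeAlgebra.ι k (Sum.inl r))
        (FreeAlgebra.ι k (Sum.inl (σ r)) * FreeAlgebra.ι k (Sum.inr 0))
  | yr (r : LaurentPolynomial k) :
      GWARel k σ a (FreeAlgebra.ι k (Sum.inr 1) * FreeAlgebra.ι k (Sum.inl r))
        (FreeAlgebra.ι k (Sum.inl (σ.symm r)) * FreeAlgebra.ι k (Sum.inr 1))
  | yx : GWARel k σ a (FreeAlgebra.ι k (Sum.inr 1) * FreeAlgebra.ι k (Sum.inr 0))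
        (FreeAlgebra.ι k (Sum.inl a))
  | xy : GWARel k σ a (FreeAlgebra.ι k (Sum.inr 0) * FreeAlgebra.ι k (Sum.inr 1))
        (FreeAlgebra.ι k (Sum.inl (σ a)))

/-- The degree-one generalized Weyl algebra `k[h^{±1}](σ, a)`, presented as the quotient of
the free algebra on `k[h^{±1}] ⊕ {x, y}` by the generalized Weyl relations. -/
abbrev GWA (k : Type*) [CommRing k] (σ : LaurentPolynomial k ≃ₐ[k] LaurentPolynomial k)
    (a : LaurentPolynomial k) :=
  RingQuot (GWARel k σ a)

namespace GWA

variable {k : Type*} [CommRing k] (σ : LaurentPolynomial k ≃ₐ[k] LaurentPolynomial k)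
  (a : LaurentPolynomial k)

/-- The copy of the Laurent polynomial `p` inside the generalized Weyl algebra. -/
noncomputable def r (p : LaurentPolynomial k) : GWA k σ a :=
  RingQuot.mkAlgHom k (GWARel k σ a) (FreeAlgebra.ι k (Sum.inl p))

/-- The element `h` of the generalized Weyl algebra. -/
noncomputable def H : GWA k σ a := r σ a (T 1)

/-- The element `h⁻¹` of the generalized Weyl algebra. -/
noncomputable def Hinv : GWA k σ a := r σ a (T (-1))

/-- The generator `x` of the generalized Weyl algebra. -/
noncomputable def x : GWA k σ a :=
  RingQuot.mkAlgHom k (GWARel k σ a) (FreeAlgebra.ι k (Sum.inr 0))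

/-- The generator `y` of the generalized Weyl algebra. -/
noncomputable def y : GWA k σ a :=
  RingQuot.mkAlgHom k (GWARel k σ a) (FreeAlgebra.ι k (Sum.inr 1))

end GWA

/-- An element `a ∈ k[h^{±1}]` is a monomial if `a = c·hⁱ` for some `c ∈ k`, `i ∈ ℤ`. -/
def LaurentPolynomial.IsMonomial {k : Type*} [CommRing k] (a : LaurentPolynomial k) : Prop :=
  ∃ (c : k) (i : ℤ), a = C c * T i

/-- A `k`-linear derivation of a (possibly noncommutative) `k`-algebra. -/
def IsDeriv {k A : Type*} [CommSemiring k] [Semiring A] [Algebra k A]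
    (D : A →ₗ[k] A) : Prop :=
  ∀ u v : A, D (u * v) = D u * v + u * D v

/-- The inner derivation `ad_t : u ↦ t u − u t`. -/
noncomputable def adDer {k A : Type*} [CommSemiring k] [Ring A] [Algebra k A] (t : A) :
    A →ₗ[k] A :=
  LinearMap.mulLeft k t - LinearMap.mulRight k t


namespace LaurentPolynomial

variable {k B : Type*} [CommSemiring k] [Semiring B] [Algebra k B]

/-- An algebra homomorphism out of `k[T;T⁻¹]` is determined by the image of `T`. -/
lemma algHom_ext_T {f g : k[T;T⁻¹] →ₐ[k] B} (h : f (T 1) = g (T 1)) : f = g :=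
  AddMonoidAlgebra.algHom_ext' (MonoidHom.ext_mint h) (by ext)

/-- Evaluation of Laurent polynomials at a unit of a possibly noncommutative algebra. -/
noncomputable def evalUnit (u : Bˣ) : k[T;T⁻¹] →ₐ[k] B :=
  AddMonoidAlgebra.lift k B ℤ ((Units.coeHom B).comp (zpowersHom Bˣ u))

@[simp] lemma evalUnit_T (u : Bˣ) (n : ℤ) :
    evalUnit (k := k) u (T n) = ((u ^ n : Bˣ) : B) := by
  rw [evalUnit, T, AddMonoidAlgebra.lift_single, one_smul]
  rfl

lemma mul_evalUnit {X : B} {u : Bˣ} (h : SemiconjBy X (u : B) (u⁻¹ : Bˣ)) (p : k[T;T⁻¹]) :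
    X * evalUnit u p = evalUnit u (invert p) * X := by
  induction p using LaurentPolynomial.induction_on' with
  | add p q hp hq => simp [mul_add, add_mul, hp, hq]
  | C_mul_T n c =>
    have hn : X * ((u ^ n : Bˣ) : B) = ((u⁻¹ ^ n : Bˣ) : B) * X := h.units_zpow_right n
    rw [← LaurentPolynomial.smul_eq_C_mul]
    simp [hn]

end LaurentPolynomial

namespace GWA

variable {k : Type*} [CommRing k] (σ : LaurentPolynomial k ≃ₐ[k] LaurentPolynomial k)
  (a : LaurentPolynomial k)

/-- The inclusion of `k[h^{±1}]` as an algebra homomorphism. -/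
noncomputable def rHom : LaurentPolynomial k →ₐ[k] GWA k σ a :=
  AlgHom.ofLinearMap
    { toFun := r σ a
      map_add' := fun p q => by
        simpa [r] using RingQuot.mkAlgHom_rel k (GWARel.add (σ := σ) (a := a) p q)
      map_smul' := fun c p => by
        simpa [r] using RingQuot.mkAlgHom_rel k (GWARel.smul (σ := σ) (a := a) c p) }
    (by simpa [r] using RingQuot.mkAlgHom_rel k (GWARel.one (σ := σ) (a := a)))
    (fun p q => by
        simpa [r] using RingQuot.mkAlgHom_rel k (GWARel.mul (σ := σ) (a := a) p q))

@[simp] lemma rHom_apply (p : LaurentPolynomial k) : rHom σ a p = r σ a p := rfl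

@[simp] lemma r_one : r σ a 1 = 1 := map_one (rHom σ a)

lemma r_mul (p q : LaurentPolynomial k) : r σ a (p * q) = r σ a p * r σ a q :=
  map_mul (rHom σ a) p q

lemma r_sub (p q : LaurentPolynomial k) : r σ a (p - q) = r σ a p - r σ a q :=
  map_sub (rHom σ a) p q

lemma r_add (p q : LaurentPolynomial k) : r σ a (p + q) = r σ a p + r σ a q :=
  map_add (rHom σ a) p q

lemma x_mul_r (p : LaurentPolynomial k) : x σ a * r σ a p = r σ a (σ p) * x σ a := by
  simpa [r, x] using RingQuot.mkAlgHom_rel k (GWARel.xr (σ := σ) (a := a) p)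

lemma y_mul_r (p : LaurentPolynomial k) : y σ a * r σ a p = r σ a (σ.symm p) * y σ a := by
  simpa [r, y] using RingQuot.mkAlgHom_rel k (GWARel.yr (σ := σ) (a := a) p)

lemma y_mul_x : y σ a * x σ a = r σ a a := by
  simpa [r, x, y] using RingQuot.mkAlgHom_rel k (GWARel.yx (σ := σ) (a := a))

lemma x_mul_y : x σ a * y σ a = r σ a (σ a) := by
  simpa [r, x, y] using RingQuot.mkAlgHom_rel k (GWARel.xy (σ := σ) (a := a))

variable {σ a} in
/-- A subalgebra containing `k[h^{±1}]`, `x` and `y` is everything. -/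
lemma mem_of_generators (S : Subalgebra k (GWA k σ a)) (hr : ∀ p, r σ a p ∈ S)
    (hx : x σ a ∈ S) (hy : y σ a ∈ S) (u : GWA k σ a) : u ∈ S := by
  obtain ⟨v, rfl⟩ := RingQuot.mkAlgHom_surjective k (GWARel k σ a) u
  induction v using FreeAlgebra.induction with
  | grade0 c => rw [AlgHom.commutes]; exact S.algebraMap_mem c
  | grade1 g =>
    match g with
    | Sum.inl p => exact hr p
    | Sum.inr 0 => exact hx
    | Sum.inr 1 => exact hy
  | mul u v hu hv => rw [map_mul]; exact S.mul_mem hu hv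
  | add u v hu hv => rw [map_add]; exact S.add_mem hu hv

variable {σ a} in
/-- An element commuting with `k[h^{±1}]`, `x` and `y` is central. -/
lemma commute_of_generators {c : GWA k σ a} (hr : ∀ p, Commute c (r σ a p))
    (hx : Commute c (x σ a)) (hy : Commute c (y σ a)) (u : GWA k σ a) : Commute c u := by
  have h := mem_of_generators (Subalgebra.centralizer k {c})
    (fun p => by simpa [Subalgebra.mem_centralizer_iff] using (hr p).eq)
    (by simpa [Subalgebra.mem_centralizer_iff] using hx.eq)
    (by simpa [Subalgebra.mem_centralizer_iff] using hy.eq) u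
  exact (Subalgebra.mem_centralizer_iff k).1 h c rfl

variable {σ a} in
lemma algHom_ext {B : Type*} [Semiring B] [Algebra k B] {f g : GWA k σ a →ₐ[k] B}
    (hH : f (H σ a) = g (H σ a)) (hx : f (x σ a) = g (x σ a)) (hy : f (y σ a) = g (y σ a)) :
    f = g := by
  have hr : f.comp (rHom σ a) = g.comp (rHom σ a) := LaurentPolynomial.algHom_ext_T hH
  refine AlgHom.ext fun u => ?_
  exact mem_of_generators (AlgHom.equalizer f g) (fun p => DFunLike.congr_fun hr p) hx hy u

/-- The generator `x` of `k[h^{±1}](σ, 1)` as a unit, with inverse `y`. -/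
noncomputable def xUnit : (GWA k σ 1)ˣ where
  val := x σ 1
  inv := y σ 1
  val_inv := by rw [x_mul_y, map_one, r_one]
  inv_val := by rw [y_mul_x, r_one]

section Lift

variable {B : Type*} [Semiring B] [Algebra k B] (f : LaurentPolynomial k →ₐ[k] B) (X Y : B)
  (hX : ∀ p, X * f p = f (σ p) * X) (hY : ∀ p, Y * f p = f (σ.symm p) * Y)
  (hYX : Y * X = f a) (hXY : X * Y = f (σ a))

/-- The universal property of the generalized Weyl algebra. -/
noncomputable def lift : GWA k σ a →ₐ[k] B :=
  RingQuot.liftAlgHom k ⟨FreeAlgebra.lift k (Sum.elim f ![X, Y]), fun u v h => by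
    cases h <;> simp [hX, hY, hYX, hXY]⟩

@[simp] lemma lift_r (p : LaurentPolynomial k) :
    lift σ a f X Y hX hY hYX hXY (r σ a p) = f p := by simp [lift, r]

@[simp] lemma lift_x : lift σ a f X Y hX hY hYX hXY (x σ a) = X := by simp [lift, x]

@[simp] lemma lift_y : lift σ a f X Y hX hY hYX hXY (y σ a) = Y := by simp [lift, y]

end Lift

/-- The map `p e_n ↦ σ(p) e_{n+1}` on the free `k[h^{±1}]`-module with basis `(e_n)_{n ∈ ℤ}`. -/
noncomputable def twistedShift (τ : LaurentPolynomial k ≃ₐ[k] LaurentPolynomial k) (m : ℤ) :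
    Module.End k (ℤ →₀ LaurentPolynomial k) :=
  Finsupp.lmapDomain _ k (· + m) ∘ₗ Finsupp.mapRange.linearMap τ.toLinearMap

@[simp] lemma twistedShift_single (τ : LaurentPolynomial k ≃ₐ[k] LaurentPolynomial k) (m n : ℤ)
    (p : LaurentPolynomial k) :
    twistedShift τ m (Finsupp.single n p) = Finsupp.single (n + m) (τ p) := by
  simp [twistedShift]

/-- The regular representation of `k[h^{±1}](σ, 1)` in the coordinates given by the powers
of `x`. -/
noncomputable def regularRep : GWA k σ 1 →ₐ[k] Module.End k (ℤ →₀ LaurentPolynomial k) :=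
  lift σ 1 (Algebra.lsmul k k _) (twistedShift σ 1) (twistedShift σ.symm (-1))
    (fun p => Finsupp.lhom_ext fun n q => by simp [-Finsupp.single_mul])
    (fun p => Finsupp.lhom_ext fun n q => by simp [-Finsupp.single_mul])
    (Finsupp.lhom_ext fun n q => by simp)
    (Finsupp.lhom_ext fun n q => by simp)

/-- The map `p e_n ↦ p xⁿ`. -/
noncomputable def ofCoords : (ℤ →₀ LaurentPolynomial k) →ₗ[k] GWA k σ 1 :=
  Finsupp.lsum k fun n =>
    LinearMap.mulRight k ((xUnit σ ^ n : (GWA k σ 1)ˣ) : GWA k σ 1) ∘ₗ (rHom σ 1).toLinearMap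

@[simp] lemma ofCoords_single (n : ℤ) (p : LaurentPolynomial k) :
    ofCoords σ (Finsupp.single n p) = r σ 1 p * ((xUnit σ ^ n : (GWA k σ 1)ˣ) : GWA k σ 1) := by
  simp [ofCoords, -Finsupp.coe_lsum, Finsupp.lsum_single]

lemma x_mul_zpow (n : ℤ) : x σ 1 * ((xUnit σ ^ n : (GWA k σ 1)ˣ) : GWA k σ 1) =
    ((xUnit σ ^ (n + 1) : (GWA k σ 1)ˣ) : GWA k σ 1) := by
  rw [add_comm, zpow_one_add, Units.val_mul]
  rfl

lemma y_mul_zpow (n : ℤ) : y σ 1 * ((xUnit σ ^ n : (GWA k σ 1)ˣ) : GWA k σ 1) =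
    ((xUnit σ ^ (n + -1) : (GWA k σ 1)ˣ) : GWA k σ 1) := by
  rw [add_comm, zpow_add, zpow_neg_one, Units.val_mul]
  rfl

lemma ofCoords_regularRep (u : GWA k σ 1) (m : ℤ →₀ LaurentPolynomial k) :
    ofCoords σ (regularRep σ u m) = u * ofCoords σ m := by
  let S : Subalgebra k (GWA k σ 1) :=
    { carrier := {u | ∀ m, ofCoords σ (regularRep σ u m) = u * ofCoords σ m}
      mul_mem' := fun {u v} hu hv m => by
        rw [map_mul, Module.End.mul_apply, hu, hv, mul_assoc]
      add_mem' := fun {u v} hu hv m => by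
        rw [map_add, LinearMap.add_apply, map_add, hu, hv, add_mul]
      algebraMap_mem' := fun c m => by
        rw [AlgHom.commutes, Module.algebraMap_end_apply, map_smul, Algebra.smul_def] }
  suffices ∀ u, u ∈ S from this u m
  refine mem_of_generators S (fun p m => ?_) (fun m => ?_) (fun m => ?_)
  · induction m using Finsupp.induction_linear with
    | zero => simp
    | add f g hf hg => rw [map_add, map_add, hf, hg, map_add, mul_add]
    | single n q =>
      simp only [regularRep, lift_r, Algebra.lsmul_coe, Finsupp.smul_single, smul_eq_mul,
        ofCoords_single, r_mul, mul_assoc]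
  · induction m using Finsupp.induction_linear with
    | zero => simp
    | add f g hf hg => rw [map_add, map_add, hf, hg, map_add, mul_add]
    | single n q =>
      simp only [regularRep, lift_x, twistedShift_single, ofCoords_single]
      rw [← mul_assoc, x_mul_r, mul_assoc, x_mul_zpow]
  · induction m using Finsupp.induction_linear with
    | zero => simp
    | add f g hf hg => rw [map_add, map_add, hf, hg, map_add, mul_add]
    | single n q =>
      simp only [regularRep, lift_y, twistedShift_single, ofCoords_single]
      rw [← mul_assoc, y_mul_r, mul_assoc, y_mul_zpow]

/-- Nonzero Laurent polynomials are left regular in `k[h^{±1}](σ, 1)`. -/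
lemma eq_zero_of_r_mul_eq_zero [IsDomain k] {p : LaurentPolynomial k} (hp : p ≠ 0)
    {u : GWA k σ 1} (h : r σ 1 p * u = 0) : u = 0 := by
  have h1 : p • regularRep σ u (Finsupp.single 0 1) = 0 := by
    have := congrArg (fun v => regularRep σ v (Finsupp.single 0 1)) h
    simpa [regularRep] using this
  have h2 := ofCoords_regularRep σ u (Finsupp.single 0 1)
  rw [(smul_eq_zero.1 h1).resolve_left hp, map_zero, ofCoords_single] at h2
  simpa using h2.symm

end GWA

section Derivation

open TrivSqZeroExt

variable {k A : Type*} [CommRing k] [Ring A] [Algebra k A]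

/-- The algebra homomorphism `u ↦ (u, D u)` into the square-zero extension of `A` by itself. -/
noncomputable def IsDeriv.toAlgHom {D : A →ₗ[k] A} (hD : IsDeriv D) :
    A →ₐ[k] TrivSqZeroExt A A :=
  AlgHom.ofLinearMap
    { toFun := fun u => (inl u + inr (D u) : TrivSqZeroExt A A)
      map_add' := fun u v => by ext <;> simp
      map_smul' := fun c u => by ext <;> simp }
    (by
      have h := hD 1 1
      simp only [mul_one, one_mul, left_eq_add] at h
      ext <;> simp [h])
    (fun u v => by ext <;> simp [hD u v, add_comm])

end Derivation

namespace IsDeriv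

variable {k A : Type*} [CommRing k] [Ring A] [Algebra k A] {D : A →ₗ[k] A}

@[simp] lemma fst_toAlgHom (hD : IsDeriv D) (u : A) : (hD.toAlgHom u).fst = u := by
  simp [toAlgHom]

@[simp] lemma snd_toAlgHom (hD : IsDeriv D) (u : A) : (hD.toAlgHom u).snd = D u := by
  simp [toAlgHom]

end IsDeriv

namespace TrivSqZeroExt

variable {k A : Type*} [CommRing k] [Ring A] [Algebra k A]

/-- A section `u ↦ (u, D u)` of the square-zero extension defines a derivation `D`. -/
lemma isDeriv_of_section (F : A →ₐ[k] TrivSqZeroExt A A) (hF : ∀ v, (F v).fst = v) :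
    ∃ D : A →ₗ[k] A, IsDeriv D ∧ ∀ v, D v = (F v).snd := by
  refine ⟨{ toFun := fun v => (F v).snd, map_add' := fun v w => ?_, map_smul' := fun c v => ?_ },
    fun v w => ?_, fun v => rfl⟩
  · rw [map_add, snd_add]
  · rw [map_smul, snd_smul, RingHom.id_apply]
  · change (F (v * w)).snd = (F v).snd * w + v * (F w).snd
    rw [map_mul, snd_mul, hF, hF, smul_eq_mul, op_smul_eq_mul, add_comm]

/-- The unit `(h, (h² - 1) z)` of the square-zero extension, for `h` a unit and `z` central. -/
def sqSubOneUnit (h : Aˣ) {z : A} (hz : ∀ u, Commute z u) : (TrivSqZeroExt A A)ˣ where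
  val := inl (h : A) + inr ((h * h - 1) * z)
  inv := inl (h⁻¹ : Aˣ).val + inr (((h⁻¹ : Aˣ) * (h⁻¹ : Aˣ) - 1) * z)
  val_inv := by
    ext
    · simp
    · simp [mul_sub, sub_mul, mul_assoc, (hz (h⁻¹ : Aˣ)).eq]
  inv_val := by
    ext
    · simp
    · simp [mul_sub, sub_mul, mul_assoc, (hz (h : A)).eq]

lemma semiconjBy_sqSubOneUnit {h : Aˣ} {z w X : A} (hz : ∀ u, Commute z u)
    (hw : ∀ u, Commute w u) (hX : X * h = (h⁻¹ : Aˣ) * X) :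
    SemiconjBy (inl X + inr (w * X)) (sqSubOneUnit h hz : TrivSqZeroExt A A)
      ((sqSubOneUnit h hz)⁻¹ : (TrivSqZeroExt A A)ˣ) := by
  change _ * (inl (h : A) + inr ((h * h - 1) * z)) =
    (inl (h⁻¹ : Aˣ).val + inr (((h⁻¹ : Aˣ) * (h⁻¹ : Aˣ) - 1) * z)) * _
  ext
  · simpa using hX
  · have hX' : ∀ c, (h⁻¹ : Aˣ) * (X * c) = X * (h * c) := fun c => by
      rw [← mul_assoc, ← hX, mul_assoc]
    have hw' : ∀ c, (h⁻¹ : Aˣ) * (w * c) = w * ((h⁻¹ : Aˣ) * c) := fun c =>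
      ((hw _).left_comm c).symm
    simp [mul_sub, sub_mul, mul_assoc, (hz X).eq, hX', hw', ← hX]
    abel

lemma mul_eq_one_of_central {w X Y : A} (hw : ∀ u, Commute w u) (hXY : X * Y = 1) :
    (inl X + inr (w * X) : TrivSqZeroExt A A) * (inl Y + inr (-w * Y)) = 1 := by
  ext
  · simpa using hXY
  · simp [mul_assoc, (hw X).symm.left_comm Y]

end TrivSqZeroExt

namespace GWA

variable {k : Type*} [CommRing k]

variable {σ : LaurentPolynomial k ≃ₐ[k] LaurentPolynomial k} {a : LaurentPolynomial k} in
lemma deriv_ext {D E : GWA k σ a →ₗ[k] GWA k σ a} (hD : IsDeriv D) (hE : IsDeriv E)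
    (hH : D (H σ a) = E (H σ a)) (hx : D (x σ a) = E (x σ a)) (hy : D (y σ a) = E (y σ a)) :
    D = E := by
  have h : hD.toAlgHom = hE.toAlgHom :=
    algHom_ext (TrivSqZeroExt.ext (by simp) (by simpa using hH))
      (TrivSqZeroExt.ext (by simp) (by simpa using hx))
      (TrivSqZeroExt.ext (by simp) (by simpa using hy))
  refine LinearMap.ext fun u => ?_
  simpa using congrArg TrivSqZeroExt.snd (DFunLike.congr_fun h u)

lemma H_mul_Hinv (σ : LaurentPolynomial k ≃ₐ[k] LaurentPolynomial k) (a : LaurentPolynomial k) :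
    H σ a * Hinv σ a = 1 := by
  rw [H, Hinv, ← r_mul, ← T_add, add_neg_cancel, T_zero, r_one]

lemma Hinv_mul_H (σ : LaurentPolynomial k ≃ₐ[k] LaurentPolynomial k) (a : LaurentPolynomial k) :
    Hinv σ a * H σ a = 1 := by
  rw [H, Hinv, ← r_mul, ← T_add, neg_add_cancel, T_zero, r_one]

/-- The element `h` as a unit. -/
noncomputable def HUnit (σ : LaurentPolynomial k ≃ₐ[k] LaurentPolynomial k)
    (a : LaurentPolynomial k) : (GWA k σ a)ˣ where
  val := H σ a
  inv := Hinv σ a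
  val_inv := H_mul_Hinv σ a
  inv_val := Hinv_mul_H σ a

open TrivSqZeroExt in
lemma exists_deriv {z₁ z₂ : GWA k invert 1} (hz₁ : ∀ u, Commute z₁ u) (hz₂ : ∀ u, Commute z₂ u) :
    ∃ D : GWA k invert 1 →ₗ[k] GWA k invert 1, IsDeriv D ∧
      D (H invert 1) = (H invert 1 * H invert 1 - 1) * z₁ ∧
      D (x invert 1) = z₂ * x invert 1 ∧ D (y invert 1) = -(z₂ * y invert 1) := by
  have eX : x invert 1 * (HUnit invert (1 : k[T;T⁻¹])).val =
      (HUnit invert (1 : k[T;T⁻¹]))⁻¹.val * x invert 1 :=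
    (x_mul_r invert 1 (T 1)).trans (by rw [invert_T]; rfl)
  have eY : y invert 1 * (HUnit invert (1 : k[T;T⁻¹])).val =
      (HUnit invert (1 : k[T;T⁻¹]))⁻¹.val * y invert 1 :=
    (y_mul_r invert 1 (T 1)).trans (by rw [invert_symm, invert_T]; rfl)
  have hw₂ : ∀ u, Commute (-z₂) u := fun u => (hz₂ u).neg_left
  have hX := mul_evalUnit (k := k) (semiconjBy_sqSubOneUnit hz₁ hz₂ eX)
  have hY := mul_evalUnit (k := k) (semiconjBy_sqSubOneUnit hz₁ hw₂ eY)
  have hXY := mul_eq_one_of_central hz₂ (xUnit invert).val_inv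
  have hYX := mul_eq_one_of_central hw₂ (xUnit invert).inv_val
  rw [neg_neg] at hYX
  have hXY' := hXY.trans (map_one (evalUnit (k := k) (sqSubOneUnit (HUnit invert 1) hz₁))).symm
  have hYX' := hYX.trans (map_one (evalUnit (k := k) (sqSubOneUnit (HUnit invert 1) hz₁))).symm
  obtain ⟨F, hFr, hFx, hFy⟩ : ∃ F : GWA k invert 1 →ₐ[k] TrivSqZeroExt (GWA k invert 1) _,
      (∀ p, F (r invert 1 p) = evalUnit (sqSubOneUnit (HUnit invert 1) hz₁) p) ∧
      F (x invert 1) = inl (x invert 1) + inr (z₂ * x invert 1) ∧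
      F (y invert 1) = inl (y invert 1) + inr (-z₂ * y invert 1) :=
    ⟨lift invert 1 _ _ _ hX hY hYX' (hXY'.trans (by rw [map_one invert])),
      fun p => lift_r .., lift_x .., lift_y ..⟩
  have hFH : F (H invert 1) = inl (H invert 1) + inr ((H invert 1 * H invert 1 - 1) * z₁) := by
    rw [H, hFr, evalUnit_T, zpow_one]
    rfl
  have hF : (fstHom k _ _).comp F = AlgHom.id k (GWA k invert 1) :=
    algHom_ext (by simp [hFH]) (by simp [hFx]) (by simp [hFy])
  obtain ⟨D, hD, hDF⟩ := isDeriv_of_section F (DFunLike.congr_fun hF)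
  exact ⟨D, hD, by simp [hDF, hFH], by simp [hDF, hFx],
    by simp [hDF, hFy, neg_mul z₂ (y invert 1)]⟩

lemma commute_x_mul_x (u : GWA k invert 1) : Commute (x invert 1 * x invert 1) u := by
  refine commute_of_generators (fun p => ?_) (by simp [commute_iff_eq, mul_assoc]) ?_ u
  · rw [commute_iff_eq, mul_assoc, x_mul_r, ← mul_assoc, x_mul_r, mul_assoc,
      involutive_invert]
  · have e₁ : x invert 1 * y invert 1 = 1 := (xUnit (k := k) invert).val_inv
    have e₂ : y invert 1 * x invert 1 = 1 := (xUnit (k := k) invert).inv_val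
    rw [commute_iff_eq, mul_assoc, e₁, ← mul_assoc, e₂, mul_one, one_mul]

lemma commute_H_add_Hinv (u : GWA k invert 1) : Commute (H invert 1 + Hinv invert 1) u := by
  rw [H, Hinv, ← r_add]
  refine commute_of_generators (fun p => ?_) ?_ ?_ u
  · rw [commute_iff_eq, ← r_mul, ← r_mul, mul_comm]
  · rw [commute_iff_eq, x_mul_r, map_add, invert_T, invert_T, neg_neg, add_comm]
  · rw [commute_iff_eq, y_mul_r, invert_symm, map_add, invert_T, invert_T, neg_neg, add_comm]

/-- If `[t, x] = z x` with `z` central then `z = 0`. -/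
lemma eq_zero_of_commutator_x {k : Type*} [Field k] (hchar : (2 : k) ≠ 0) {z t : GWA k invert 1}
    (hz : ∀ u, Commute z u) (h : t * x invert 1 - x invert 1 * t = z * x invert 1) : z = 0 := by
  have e₁ : x invert 1 * y invert 1 = 1 := (xUnit (k := k) invert).val_inv
  have h₁ : (z + z) * (x invert 1 * x invert 1) = 0 :=
    calc (z + z) * (x invert 1 * x invert 1)
        = z * x invert 1 * x invert 1 + x invert 1 * (z * x invert 1) := by
          rw [add_mul, ← mul_assoc, ← mul_assoc (x invert 1), (hz (x invert 1)).eq]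
      _ = t * (x invert 1 * x invert 1) - x invert 1 * x invert 1 * t := by
          rw [← h]
          simp only [mul_sub, sub_mul, mul_assoc]
          abel
      _ = 0 := by rw [(commute_x_mul_x t).eq, sub_self]
  have h₄ : z + z = 0 :=
    calc z + z = (z + z) * (x invert 1 * (x invert 1 * y invert 1) * y invert 1) := by
          rw [e₁, mul_one, e₁, mul_one]
      _ = (z + z) * (x invert 1 * x invert 1) * (y invert 1 * y invert 1) := by
          simp only [mul_assoc]
      _ = 0 := by rw [h₁, zero_mul]
  rw [← two_smul k] at h₄
  exact (smul_eq_zero.1 h₄).resolve_left hchar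

/-- If `[t, u] = (u² - 1) z` with `t` commuting with `u + u⁻¹` and `z` commuting with `u⁻¹`,
then `(u - u⁻¹)² z = 0`. -/
lemma sub_mul_sub_mul_eq_zero {A : Type*} [Ring A] {u v t z : A} (e₁ : u * v = 1)
    (e₂ : v * u = 1) (hc : Commute (u + v) t) (hz : Commute z v)
    (h : t * u - u * t = (u * u - 1) * z) : (u - v) * ((u - v) * z) = 0 := by
  have e₃ : ∀ c, v * (u * c) = c := fun c => by rw [← mul_assoc, e₂, one_mul]
  have h₁ : t * v - v * t = -(v * (t * u - u * t) * v) := by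
    simp [mul_sub, sub_mul, mul_assoc, e₁, e₃]
  have h₂ : v * ((u * u - 1) * z) * v = z - v * (v * z) := by
    simp [mul_sub, sub_mul, mul_assoc, hz.eq, e₃, ← mul_assoc u v, e₁]
  rw [h, h₂] at h₁
  calc (u - v) * ((u - v) * z)
      = u * u * z - u * v * z - v * u * z + v * (v * z) := by noncomm_ring
    _ = (u * u - 1) * z + -(z - v * (v * z)) := by rw [e₁, e₂]; noncomm_ring
    _ = (t * u - u * t) + (t * v - v * t) := by rw [h, h₁]
    _ = t * (u + v) - (u + v) * t := by noncomm_ring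
    _ = 0 := by rw [hc.eq, sub_self]

/-- If `[t, h] = (h² - 1) z` with `z` central then `z = 0`. -/
lemma eq_zero_of_commutator_H {k : Type*} [Field k] {z t : GWA k invert 1}
    (hz : ∀ u, Commute z u)
    (h : t * H invert 1 - H invert 1 * t = (H invert 1 * H invert 1 - 1) * z) : z = 0 := by
  have hp : (T 1 - T (-1) : k[T;T⁻¹]) ≠ 0 := fun h0 => by
    have := congrArg (fun q : k[T;T⁻¹] => q.coeff 1) h0
    simp [T, AddMonoidAlgebra.coeff_single, -single_eq_C_mul_T] at this
  refine eq_zero_of_r_mul_eq_zero invert hp (eq_zero_of_r_mul_eq_zero invert hp ?_)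
  rw [r_sub]
  change (H invert 1 - Hinv invert 1) * ((H invert 1 - Hinv invert 1) * z) = 0
  exact sub_mul_sub_mul_eq_zero (H_mul_Hinv _ _) (Hinv_mul_H _ _) (commute_H_add_Hinv t)
    (hz (Hinv invert 1)) h

end GWA

/-- Over a field of characteristic not `2`, in `A = k[h^{±1}](σ_inv, 1)`
with `σ_inv(h) = h⁻¹`, for central `z₁, z₂` there is a unique derivation `D` with
`D(h) = (h² − 1) z₁`, `D(x) = z₂ x`, `D(y) = −z₂ y`; and if `(z₁, z₂) ≠ (0, 0)` then any
such `D` is outer, i.e. not of the form `ad_t`. -/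
theorem outer_derivation_involution_gwa_one (k : Type*) [Field k] (hchar : (2 : k) ≠ 0)
    (σ : LaurentPolynomial k ≃ₐ[k] LaurentPolynomial k) (hσ : σ (T 1) = T (-1))
    (z₁ z₂ : GWA k σ 1) (hz₁ : z₁ ∈ Subalgebra.center k (GWA k σ 1))
    (hz₂ : z₂ ∈ Subalgebra.center k (GWA k σ 1)) :
    (∃! D : GWA k σ 1 →ₗ[k] GWA k σ 1,
        IsDeriv D ∧ D (GWA.H σ 1) = (GWA.H σ 1 * GWA.H σ 1 - 1) * z₁ ∧
          D (GWA.x σ 1) = z₂ * GWA.x σ 1 ∧ D (GWA.y σ 1) = -(z₂ * GWA.y σ 1)) ∧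
      (¬(z₁ = 0 ∧ z₂ = 0) →
        ∀ D : GWA k σ 1 →ₗ[k] GWA k σ 1,
          IsDeriv D → D (GWA.H σ 1) = (GWA.H σ 1 * GWA.H σ 1 - 1) * z₁ →
            D (GWA.x σ 1) = z₂ * GWA.x σ 1 → D (GWA.y σ 1) = -(z₂ * GWA.y σ 1) →
            ∀ t : GWA k σ 1, D ≠ adDer (k := k) t) := by
  obtain rfl : σ = invert :=
    AlgEquiv.coe_toAlgHom_injective (algHom_ext_T (by simpa using hσ))
  have hc₁ : ∀ u, Commute z₁ u := fun u => (Subalgebra.mem_center_iff.1 hz₁ u).symm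
  have hc₂ : ∀ u, Commute z₂ u := fun u => (Subalgebra.mem_center_iff.1 hz₂ u).symm
  refine ⟨?_, fun hne D _ hH hx _ t hDt => hne ⟨?_, ?_⟩⟩
  · obtain ⟨D, hD, hH, hx, hy⟩ := GWA.exists_deriv hc₁ hc₂
    exact ⟨D, ⟨hD, hH, hx, hy⟩, fun E ⟨hE, hH', hx', hy'⟩ =>
      GWA.deriv_ext hE hD (hH'.trans hH.symm) (hx'.trans hx.symm) (hy'.trans hy.symm)⟩
  · rw [hDt] at hH
    exact GWA.eq_zero_of_commutator_H hc₁ hH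
  · rw [hDt] at hx
    exact GWA.eq_zero_of_commutator_x hchar hc₂ hx
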